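/- There is an absolute constant c > 0 such that the following holds. Let ‖·‖ be a norm on ℝ^d with dual unit ball B°, let Σ be a positive semidefinite covariance matrix, let δ ∈ (0, 1/4), and let N ≥ log(2/δ). Suppose Ψ̂_N : (ℝ^d)^N → ℝ^d is an estimator such that for every μ ∈ ℝ^d, when X₁,…,X_N are i.i.d. Gaussian with mean μ and covariance Σ, P(‖Ψ̂_N(X₁,…,X_N) − μ‖ ≤ ε) ≥ 1 − δ. Then ε ≥ c · R · √(log(2/δ)/N), where R = sup_{x*∈B°} (E(x*(X−μ))²)^{1/2} = sup_{x*∈B°} (x*ᵀ Σ x*)^{1/2}. -/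

import Mathlib

open MeasureTheory ProbabilityTheory Matrix
open scoped ENNReal

/-- The unit ball of the dual norm of `nrm`, identifying linear functionals on `ℝ^d`
with vectors via the standard inner product. -/
def dualBall {d : ℕ} (nrm : (Fin d → ℝ) → ℝ) : Set (Fin d → ℝ) :=
  {t | ∀ x, nrm x ≤ 1 → ∑ i, t i * x i ≤ 1}

/-- The standard Gaussian measure on `ℝ^d`. -/
noncomputable def stdGaussian (d : ℕ) : Measure (Fin d → ℝ) :=
  Measure.pi fun _ : Fin d => gaussianReal 0 1

/-- The Gaussian measure on `ℝ^d` with mean `μ` and covariance `Σ = A Aᵀ`, realized as the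
law of `μ + A G` for a standard Gaussian vector `G`. -/
noncomputable def gaussianVec {d : ℕ} (μ : Fin d → ℝ) (A : Matrix (Fin d) (Fin d) ℝ) :
    Measure (Fin d → ℝ) :=
  Measure.map (fun x => μ + A.mulVec x) (stdGaussian d)

/-- `ν` has a density with respect to `μ` whose second moment is at most `K`. -/
def HasDensitySqLE {α : Type*} [MeasurableSpace α] (μ ν : Measure α) (K : ℝ≥0∞) : Prop :=
  ∃ f : α → ℝ≥0∞, Measurable f ∧ ν = μ.withDensity f ∧ ∫⁻ x, f x ^ 2 ∂μ ≤ K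

theorem HasDensitySqLE.sq_measure_le {α : Type*} [MeasurableSpace α] {μ ν : Measure α}
    {K : ℝ≥0∞} (h : HasDensitySqLE μ ν K) {s : Set α} (hs : MeasurableSet s) :
    ν s ^ 2 ≤ K * μ s := by
  obtain ⟨f, hf, rfl, hK⟩ := h
  have hind : Measurable (s.indicator (1 : α → ℝ≥0∞)) := measurable_one.indicator hs
  have key := ENNReal.lintegral_mul_le_Lp_mul_Lq μ Real.HolderConjugate.two_two
    hf.aemeasurable hind.aemeasurable
  have h1 : ∫⁻ a, (f * s.indicator (1 : α → ℝ≥0∞)) a ∂μ = μ.withDensity f s := by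
    rw [withDensity_apply _ hs, ← lintegral_indicator hs]
    congr with a
    by_cases ha : a ∈ s <;> simp [ha]
  have h2 : ∫⁻ a, s.indicator (1 : α → ℝ≥0∞) a ^ (2 : ℝ) ∂μ = μ s := by
    rw [← lintegral_indicator_one hs]
    congr with a
    by_cases ha : a ∈ s <;> simp [ha]
  rw [h1, h2] at key
  have hsq : ∀ a : ℝ≥0∞, (a ^ (1 / 2 : ℝ)) ^ 2 = a := fun a => by
    rw [← ENNReal.rpow_natCast, ← ENNReal.rpow_mul]; norm_num
  calc μ.withDensity f s ^ 2
      ≤ ((∫⁻ a, f a ^ (2 : ℝ) ∂μ) ^ (1 / 2 : ℝ) * μ s ^ (1 / 2 : ℝ)) ^ 2 := by gcongr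
    _ = (∫⁻ a, f a ^ 2 ∂μ) * μ s := by rw [mul_pow, hsq, hsq]; simp
    _ ≤ K * μ s := by gcongr

theorem lintegral_pi_prod_eq_prod {ι : Type*} [Fintype ι] {α : ι → Type*}
    [∀ i, MeasurableSpace (α i)] (μ : ∀ i, Measure (α i)) [∀ i, IsProbabilityMeasure (μ i)]
    {f : ∀ i, α i → ℝ≥0∞} (hf : ∀ i, Measurable (f i)) :
    ∫⁻ x, ∏ i, f i (x i) ∂(Measure.pi μ) = ∏ i, ∫⁻ x, f i x ∂(μ i) := by
  rw [lintegral_prod_eq_prod_lintegral_of_indepFun Finset.univ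
    (fun i (x : ∀ i, α i) => f i (x i)) (iIndepFun_pi fun i => (hf i).aemeasurable)
    fun i => (hf i).comp (measurable_pi_apply i)]
  exact Finset.prod_congr rfl fun i _ => (measurePreserving_eval μ i).lintegral_comp (hf i)

theorem HasDensitySqLE.pi {ι : Type*} [Fintype ι] {α : ι → Type*}
    [∀ i, MeasurableSpace (α i)] {μ ν : ∀ i, Measure (α i)} [∀ i, IsProbabilityMeasure (μ i)]
    [∀ i, SigmaFinite (ν i)] {K : ι → ℝ≥0∞} (h : ∀ i, HasDensitySqLE (μ i) (ν i) (K i)) :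
    HasDensitySqLE (Measure.pi μ) (Measure.pi ν) (∏ i, K i) := by
  choose f hf hν hK using h
  refine ⟨fun x => ∏ i, f i (x i), by fun_prop, Measure.pi_eq fun s hs => ?_, ?_⟩
  · rw [withDensity_apply _ (MeasurableSet.univ_pi hs),
      ← lintegral_indicator (MeasurableSet.univ_pi hs)]
    have : (Set.univ.pi s).indicator (fun x => ∏ i, f i (x i))
        = fun x => ∏ i, (s i).indicator (f i) (x i) := by
      ext x
      by_cases hx : x ∈ Set.univ.pi s
      · rw [Set.indicator_of_mem hx]
        exact Finset.prod_congr rfl fun i _ => (Set.indicator_of_mem (hx i trivial) _).symm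
      · rw [Set.indicator_of_notMem hx]
        obtain ⟨i, hi⟩ : ∃ i, x i ∉ s i := by simpa [Set.mem_pi] using hx
        exact (Finset.prod_eq_zero (Finset.mem_univ i) (Set.indicator_of_notMem hi _)).symm
    rw [this, lintegral_pi_prod_eq_prod μ fun i => (hf i).indicator (hs i)]
    refine Finset.prod_congr rfl fun i _ => ?_
    rw [lintegral_indicator (hs i), hν i, withDensity_apply _ (hs i)]
  · simp_rw [← Finset.prod_pow]
    rw [lintegral_pi_prod_eq_prod μ fun i => (hf i).pow_const 2]
    exact Finset.prod_le_prod' fun i _ => hK i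

theorem hasDensitySqLE_gaussianReal (a : ℝ) :
    HasDensitySqLE (gaussianReal 0 1) (gaussianReal a 1) (ENNReal.ofReal (Real.exp (a ^ 2))) := by
  refine ⟨fun x => ENNReal.ofReal (Real.exp (a * x - a ^ 2 / 2)), by fun_prop, ?_, le_of_eq ?_⟩
  · rw [gaussianReal_of_var_ne_zero _ one_ne_zero, gaussianReal_of_var_ne_zero _ one_ne_zero,
      ← withDensity_mul _ (measurable_gaussianPDF 0 1) (by fun_prop)]
    congr with x
    rw [Pi.mul_apply, gaussianPDF, gaussianPDF,
      ← ENNReal.ofReal_mul (gaussianPDFReal_nonneg 0 1 x), gaussianPDFReal, gaussianPDFReal,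
      mul_assoc _ (Real.exp _) (Real.exp _), ← Real.exp_add]
    congr 3
    simp
    ring
  · have hexp : ∀ x, ENNReal.ofReal (Real.exp (a * x - a ^ 2 / 2)) ^ 2
        = ENNReal.ofReal (Real.exp (-a ^ 2) * Real.exp (2 * a * x)) := fun x => by
      rw [← ENNReal.ofReal_pow (Real.exp_pos _).le, ← Real.exp_nat_mul, ← Real.exp_add]
      congr 2
      push_cast
      ring
    simp_rw [hexp]
    have hmgf : ∫ x, Real.exp (2 * a * x) ∂gaussianReal 0 1 = Real.exp (2 * a ^ 2) := by
      have := congrFun (mgf_fun_id_gaussianReal (μ := 0) (v := 1)) (2 * a)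
      rw [mgf] at this
      rw [this]
      congr 1
      push_cast
      ring
    rw [← ofReal_integral_eq_lintegral_ofReal
      ((integrable_exp_mul_gaussianReal (2 * a)).const_mul _)
      (Filter.Eventually.of_forall fun x => by positivity), integral_const_mul, hmgf,
      ← Real.exp_add]
    congr 2
    ring

theorem gaussianVec_mulVec {d : ℕ} (A : Matrix (Fin d) (Fin d) ℝ) (w : Fin d → ℝ) :
    gaussianVec (A *ᵥ w) A
      = Measure.map (fun x => A *ᵥ x) (Measure.pi fun j => gaussianReal (w j) 1) := by
  have hshift : (Measure.pi fun j => gaussianReal (w j) 1)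
      = Measure.map (fun x j => w j + x j) (Measure.pi fun _ : Fin d => gaussianReal 0 1) := by
    rw [Measure.pi_map_pi (f := fun j x => w j + x) fun j => by fun_prop]
    simp [gaussianReal_map_const_add]
  have hA : Measurable fun x : Fin d → ℝ => A *ᵥ x :=
    (Continuous.matrix_mulVec continuous_const continuous_id).measurable
  rw [hshift, Measure.map_map hA (by fun_prop), gaussianVec, _root_.stdGaussian]
  congr 1
  ext1 x
  exact (Matrix.mulVec_add A w x).symm

theorem sq_pi_gaussianVec_mulVec_le {d N : ℕ} (A : Matrix (Fin d) (Fin d) ℝ) (w : Fin d → ℝ)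
    {s : Set (Fin N → Fin d → ℝ)} (hs : MeasurableSet s) :
    (Measure.pi fun _ : Fin N => gaussianVec (A *ᵥ w) A) s ^ 2
      ≤ ENNReal.ofReal (Real.exp (N * (w ⬝ᵥ w)))
        * (Measure.pi fun _ : Fin N => gaussianVec 0 A) s := by
  have hA : Measurable fun x : Fin d → ℝ => A *ᵥ x :=
    (Continuous.matrix_mulVec continuous_const continuous_id).measurable
  have hmap : ∀ v : Fin d → ℝ, (Measure.pi fun _ : Fin N => gaussianVec (A *ᵥ v) A)
      = Measure.map (fun x i => A *ᵥ x i)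
        (Measure.pi fun _ : Fin N => Measure.pi fun j => gaussianReal (v j) 1) := fun v => by
    have (_ : Fin N) : IsProbabilityMeasure
        (Measure.map (fun x => A *ᵥ x) (Measure.pi fun j => gaussianReal (v j) 1)) :=
      Measure.isProbabilityMeasure_map hA.aemeasurable
    rw [gaussianVec_mulVec, Measure.pi_map_pi (f := fun _ x => A *ᵥ x) fun _ => hA.aemeasurable]
  have hT : Measurable fun (x : Fin N → Fin d → ℝ) i => A *ᵥ x i :=
    measurable_pi_lambda _ fun i => hA.comp (measurable_pi_apply i)
  have h0 := hmap 0
  rw [Matrix.mulVec_zero] at h0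
  rw [hmap w, h0, Measure.map_apply hT hs, Measure.map_apply hT hs]
  have key := (HasDensitySqLE.pi fun _ : Fin N => HasDensitySqLE.pi fun j =>
    hasDensitySqLE_gaussianReal (w j)).sq_measure_le (hT hs)
  refine key.trans_eq ?_
  congr 1
  rw [Finset.prod_const, Finset.card_univ, Fintype.card_fin,
    ← ENNReal.ofReal_prod_of_nonneg fun j _ => (Real.exp_pos _).le, ← Real.exp_sum,
    ← ENNReal.ofReal_pow (Real.exp_pos _).le, ← Real.exp_nat_mul]
  simp [dotProduct, sq]

theorem isProbabilityMeasure_gaussianVec {d : ℕ} (μ : Fin d → ℝ)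
    (A : Matrix (Fin d) (Fin d) ℝ) : IsProbabilityMeasure (gaussianVec μ A) := by
  have : IsProbabilityMeasure (_root_.stdGaussian d) := by
    unfold _root_.stdGaussian; infer_instance
  exact Measure.isProbabilityMeasure_map
    (continuous_const.add (Continuous.matrix_mulVec continuous_const
      continuous_id)).measurable.aemeasurable

theorem abs_dotProduct_le_of_mem_dualBall {d : ℕ} {nrm : (Fin d → ℝ) → ℝ}
    (hsmul : ∀ (a : ℝ) (x : Fin d → ℝ), nrm (a • x) = |a| * nrm x)
    (hpos : ∀ x, x ≠ 0 → 0 < nrm x) {t : Fin d → ℝ} (ht : t ∈ dualBall nrm) (y : Fin d → ℝ) :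
    |t ⬝ᵥ y| ≤ nrm y := by
  have hle : ∀ y, t ⬝ᵥ y ≤ nrm y := fun y => by
    rcases eq_or_ne y 0 with rfl | hy
    · simpa using (hsmul 0 0).ge
    · have hn := hpos y hy
      have h1 : t ⬝ᵥ ((nrm y)⁻¹ • y) ≤ 1 :=
        ht _ (by rw [hsmul, abs_of_pos (inv_pos.2 hn), inv_mul_cancel₀ hn.ne'])
      rw [dotProduct_smul, smul_eq_mul, inv_mul_le_iff₀ hn] at h1
      simpa using h1
  refine abs_le'.2 ⟨hle y, ?_⟩
  have h2 := hle (-y)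
  have h3 := hsmul (-1) y
  simp only [neg_smul, one_smul, abs_neg, abs_one, one_mul] at h3
  rwa [dotProduct_neg, h3] at h2

theorem mul_exp_log_div_four_lt {δ : ℝ} (h0 : 0 < δ) (h1 : δ < 1 / 4) :
    Real.exp (Real.log (2 / δ) / 4) * δ < (1 - δ) ^ 2 := by
  set F := Real.exp (Real.log (2 / δ) / 4) with hF
  have hFpos : 0 < F := Real.exp_pos _
  have hF4 : F ^ 4 * δ = 2 := by
    rw [hF, ← Real.exp_nat_mul]
    push_cast
    rw [mul_div_cancel₀ _ (by norm_num : (4 : ℝ) ≠ 0), Real.exp_log (by positivity),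
      div_mul_cancel₀ _ h0.ne']
  have hF8 : 8 < F ^ 4 := by nlinarith [pow_pos hFpos 4]
  have hF1 : 1.6 < F := by
    by_contra! h
    have := pow_le_pow_left₀ hFpos.le h 4
    norm_num at this
    linarith
  have hF3 : 4 < F ^ 3 := by
    have := pow_lt_pow_left₀ hF1 (by norm_num) (n := 3) (by norm_num)
    norm_num at this
    linarith
  have hprod : F ^ 3 * (F * δ) = 2 := by rw [← hF4]; ring
  have hFδ : 0 < F * δ := by positivity
  nlinarith


/-- **Necessity of the `R √(log(2/δ)/N)` term.** There is an absolute constant `c > 0` such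
that for every norm on `ℝ^d`, every positive semidefinite covariance matrix `Σ`, every
`δ ∈ (0, 1/4)` and every `N ≥ log(2/δ)`: if a measurable estimator `Ψ̂_N` satisfies, for
every mean `μ ∈ ℝ^d`, `P(‖Ψ̂_N(X₁,…,X_N) - μ‖ ≤ ε) ≥ 1 - δ` when `X₁,…,X_N` are i.i.d.
Gaussian with mean `μ` and covariance `Σ`, then `ε ≥ c R √(log(2/δ)/N)`, where
`R = sup_{x* ∈ B°} (x*ᵀ Σ x*)^{1/2}`. -/
theorem gaussian_lower_bound_R_term :
    ∃ c : ℝ, 0 < c ∧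
    ∀ (d N : ℕ) (nrm : (Fin d → ℝ) → ℝ),
    (∀ x y, nrm (x + y) ≤ nrm x + nrm y) →
    (∀ (a : ℝ) (x : Fin d → ℝ), nrm (a • x) = |a| * nrm x) →
    (∀ x, x ≠ 0 → 0 < nrm x) →
    ∀ (Sig A : Matrix (Fin d) (Fin d) ℝ), Sig.PosSemidef → A * Aᵀ = Sig →
    ∀ δ : ℝ, 0 < δ → δ < 1/4 → Real.log (2 / δ) ≤ N →
    ∀ Ψ : (Fin N → Fin d → ℝ) → (Fin d → ℝ), Measurable Ψ →
    ∀ ε : ℝ,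
    (∀ μ : Fin d → ℝ,
      1 - ENNReal.ofReal δ ≤
        (Measure.pi fun _ : Fin N => gaussianVec μ A) {x | nrm (Ψ x - μ) ≤ ε}) →
    c * (sSup {r : ℝ | ∃ t ∈ dualBall nrm, r = Real.sqrt (t ⬝ᵥ Sig.mulVec t)}) *
        Real.sqrt (Real.log (2 / δ) / N) ≤ ε := by
  refine ⟨1 / 4, by norm_num, ?_⟩
  intro d N nrm _ hsmul hpos Sig A _ hA δ hδ0 hδ1 hN Ψ hΨ ε hε
  have hprob (μ : Fin d → ℝ) : IsProbabilityMeasure (gaussianVec μ A) :=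
    isProbabilityMeasure_gaussianVec μ A
  have hL : 0 < Real.log (2 / δ) := Real.log_pos (by rw [lt_div_iff₀ hδ0]; linarith)
  have hNpos : (0 : ℝ) < N := hL.trans_le hN
  have hδlt : ENNReal.ofReal δ < 1 := by
    rw [← ENNReal.ofReal_one]
    exact (ENNReal.ofReal_lt_ofReal_iff one_pos).2 (by linarith)
  have hsub : 1 - ENNReal.ofReal δ = ENNReal.ofReal (1 - δ) := by
    rw [ENNReal.ofReal_sub _ hδ0.le, ENNReal.ofReal_one]
  have hε0 : 0 ≤ ε := by
    obtain ⟨x, hx⟩ : {x | nrm (Ψ x - 0) ≤ ε}.Nonempty := by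
      refine nonempty_of_measure_ne_zero (μ := Measure.pi fun _ : Fin N => gaussianVec 0 A) ?_
      exact ((tsub_pos_of_lt hδlt).trans_le (hε 0)).ne'
    rcases eq_or_ne (Ψ x - 0) 0 with h | h
    · have : nrm 0 = 0 := by simpa using hsmul 0 0
      rwa [Set.mem_ofPred_eq, h, this] at hx
    · exact (hpos _ h).le.trans hx
  have hq : 0 < Real.sqrt (Real.log (2 / δ) / N) := Real.sqrt_pos.2 (div_pos hL hNpos)
  have hqsq := Real.sq_sqrt (div_pos hL hNpos).le
  set q := Real.sqrt (Real.log (2 / δ) / N)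
  suffices h : ∀ t ∈ dualBall nrm, 1 / 4 * Real.sqrt (t ⬝ᵥ Sig.mulVec t) * q ≤ ε by
    have hS : sSup {r : ℝ | ∃ t ∈ dualBall nrm, r = Real.sqrt (t ⬝ᵥ Sig.mulVec t)}
        ≤ ε / (1 / 4 * q) := by
      refine Real.sSup_le ?_ (by positivity)
      rintro r ⟨t, ht, rfl⟩
      rw [le_div_iff₀ (by positivity)]
      linarith [h t ht]
    rw [le_div_iff₀ (by positivity)] at hS
    linarith
  intro t ht
  have hu : t ⬝ᵥ Sig.mulVec t = (Aᵀ *ᵥ t) ⬝ᵥ (Aᵀ *ᵥ t) := by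
    rw [← hA, ← Matrix.mulVec_mulVec, Matrix.dotProduct_mulVec, ← Matrix.mulVec_transpose]
  rw [hu]
  set u := Aᵀ *ᵥ t with hudef
  have hs0 := Real.sqrt_nonneg (u ⬝ᵥ u)
  have hssq : Real.sqrt (u ⬝ᵥ u) ^ 2 = u ⬝ᵥ u :=
    Real.sq_sqrt (Finset.sum_nonneg fun i _ => mul_self_nonneg _)
  set s := Real.sqrt (u ⬝ᵥ u)
  by_contra! hlt
  have hs : 0 < s := by
    rcases hs0.eq_or_lt with h | h
    · rw [← h] at hlt
      simp only [mul_zero, zero_mul] at hlt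
      exact absurd hε0 hlt.not_ge
    · exact h
  -- The means `0` and `A w` are separated by more than `2 ε` in the direction `t`.
  set w := (q / (2 * s)) • u with hw
  have hww : w ⬝ᵥ w = q ^ 2 / 4 := by
    rw [hw, smul_dotProduct, dotProduct_smul, ← hssq, smul_eq_mul, smul_eq_mul]
    field_simp
    norm_num
  have htw : t ⬝ᵥ (A *ᵥ w) = s * q / 2 := by
    rw [Matrix.dotProduct_mulVec, ← Matrix.mulVec_transpose, ← hudef, hw, dotProduct_smul,
      ← hssq, smul_eq_mul]
    field_simp
  let E : (Fin d → ℝ) → Set (Fin N → Fin d → ℝ) := fun μ => {x | |t ⬝ᵥ (Ψ x - μ)| ≤ ε}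
  have hEmeas (μ : Fin d → ℝ) : MeasurableSet (E μ) := by
    have : Measurable fun y : Fin d → ℝ => |t ⬝ᵥ (y - μ)| :=
      (continuous_const.dotProduct (continuous_id.sub continuous_const)).abs.measurable
    exact measurableSet_le (this.comp hΨ) measurable_const
  have hE (μ : Fin d → ℝ) : ENNReal.ofReal (1 - δ)
      ≤ (Measure.pi fun _ : Fin N => gaussianVec μ A) (E μ) := by
    rw [← hsub]
    exact (hε μ).trans (measure_mono fun x hx =>
      (abs_dotProduct_le_of_mem_dualBall hsmul hpos ht _).trans hx)
  have hdisj : E (A *ᵥ w) ⊆ (E 0)ᶜ := by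
    intro x hx hx0
    have h1 := abs_le.1 (show |t ⬝ᵥ (Ψ x - A *ᵥ w)| ≤ ε from hx)
    have h2 := abs_le.1 (show |t ⬝ᵥ (Ψ x - 0)| ≤ ε from hx0)
    rw [dotProduct_sub, htw] at h1
    rw [sub_zero] at h2
    linarith [h1.1, h2.2]
  have hsmall : (Measure.pi fun _ : Fin N => gaussianVec 0 A) (E (A *ᵥ w))
      ≤ ENNReal.ofReal δ := by
    refine (measure_mono hdisj).trans ?_
    rw [prob_compl_eq_one_sub (hEmeas 0)]
    refine (tsub_le_tsub_left (hE 0) 1).trans_eq ?_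
    rw [← ENNReal.ofReal_one, ← ENNReal.ofReal_sub _ (by linarith), sub_sub_cancel]
  have hchain : ENNReal.ofReal (1 - δ) ^ 2
      ≤ ENNReal.ofReal (Real.exp (N * (w ⬝ᵥ w))) * ENNReal.ofReal δ :=
    (pow_le_pow_left₀ zero_le (hE (A *ᵥ w)) 2).trans
      ((sq_pi_gaussianVec_mulVec_le A w (hEmeas _)).trans (by gcongr))
  rw [← ENNReal.ofReal_pow (by linarith), ← ENNReal.ofReal_mul (Real.exp_pos _).le,
    ENNReal.ofReal_le_ofReal_iff (by positivity), hww, hqsq] at hchain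
  refine absurd (mul_exp_log_div_four_lt hδ0 hδ1) (not_lt.2 (hchain.trans_eq ?_))
  congr 2
  field_simp
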